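/- arXiv:2502.11402 — 3 statements merged into one kernel-verified Lean document; each statement's English description precedes it below -/
import Mathlib

section
/- Let d be a squarefree positive integer with d ≡ 1 or 2 (mod 4), and let m be a squarefree positive integer with gcd(m, 2d) = 1 and prime factorization m = p₁⋯p_r. Then there exist integers x, y with x² + d·y² = m if and only if there exist prime ideals 𝔮₁, …, 𝔮_r of ℤ[√-d] with N(𝔮_i) = p_i for each i such that the product 𝔮₁⋯𝔮_r is a principal ideal. -/
/-- The coordinates with respect to the `ℤ`-basis `1, √d` of `ℤ[√d]`. -/
def Zsqrtd.coordEquiv (d : ℤ) : ℤ√d ≃ₗ[ℤ] (Fin 2 → ℤ) where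
  toFun z := ![z.re, z.im]
  invFun v := ⟨v 0, v 1⟩
  map_add' z w := by ext i; fin_cases i <;> simp
  map_smul' n z := by ext i; fin_cases i <;> simp [zsmul_eq_mul]
  left_inv z := rfl
  right_inv v := by ext i; fin_cases i <;> rfl

theorem Zsqrtd.coordEquiv_apply {d : ℤ} (z : ℤ√d) : Zsqrtd.coordEquiv d z = ![z.re, z.im] := rfl

theorem Zsqrtd.coordEquiv_symm_apply {d : ℤ} (v : Fin 2 → ℤ) :
    (Zsqrtd.coordEquiv d).symm v = ⟨v 0, v 1⟩ := rfl

/-- The index of a principal ideal of `ℤ[√d]` is the absolute value of the norm of a generator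
of nonzero norm. -/
theorem Zsqrtd.card_quotient_span_singleton {d : ℤ} {z : ℤ√d} (hz : z.norm ≠ 0) :
    Nat.card (ℤ√d ⧸ Ideal.span {z}) = z.norm.natAbs := by
  let b := Module.Basis.ofEquivFun (Zsqrtd.coordEquiv d)
  have : Module.Free ℤ (ℤ√d) := Module.Free.of_basis b
  have : Module.Finite ℤ (ℤ√d) := Module.Finite.of_basis b
  let f : ℤ√d →ₗ[ℤ] ℤ√d := LinearMap.mulLeft ℤ z
  have hf : Function.Injective f := by
    refine (injective_iff_map_eq_zero f).2 fun x hx => ?_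
    have h : (z.norm : ℤ√d) * x = 0 := by
      rw [Zsqrtd.norm_eq_mul_conj, mul_right_comm]
      simp only [f, LinearMap.mulLeft_apply] at hx
      rw [hx, zero_mul]
    exact Zsqrtd.eq_of_smul_eq_smul_left hz (by rw [h, mul_zero])
  have hrange : LinearMap.range f = (Ideal.span {z}).restrictScalars ℤ := by
    ext x
    simp [f, Ideal.mem_span_singleton, dvd_def, eq_comm]
  have hdet : LinearMap.det f = z.norm := by
    rw [← LinearMap.det_toMatrix b, Matrix.det_fin_two]
    simp [LinearMap.toMatrix_apply, b, f, Zsqrtd.coordEquiv_apply,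
      Zsqrtd.coordEquiv_symm_apply, Zsqrtd.norm_def]
  have h := Submodule.natAbs_det_equiv (LinearMap.range f) (LinearEquiv.ofInjective f hf)
  have hcomp : (LinearMap.range f).subtype ∘ₗ AddMonoidHom.toIntLinearMap
      (LinearEquiv.ofInjective f hf : ℤ√d →+ LinearMap.range f) = f := by
    ext x <;> rfl
  rw [hcomp, hdet, hrange] at h
  exact h.symm

/-- If `x² - d y²` vanishes modulo a prime `p` not dividing `y`, then `x + y√d` lies in a prime
ideal of index `p`. -/
theorem Zsqrtd.exists_isPrime_card_quotient_eq {d : ℤ} {z : ℤ√d} {p : ℕ} (hp : p.Prime)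
    (hnorm : (p : ℤ) ∣ z.norm) (him : ¬ (p : ℤ) ∣ z.im) :
    ∃ I : Ideal (ℤ√d), I.IsPrime ∧ Nat.card (ℤ√d ⧸ I) = p ∧ z ∈ I := by
  have : Fact p.Prime := ⟨hp⟩
  have hy : (z.im : ZMod p) ≠ 0 := by rwa [Ne, ZMod.intCast_zmod_eq_zero_iff_dvd]
  have hn : (z.re : ZMod p) * z.re - d * z.im * z.im = 0 := by
    have h := (ZMod.intCast_zmod_eq_zero_iff_dvd z.norm p).2 hnorm
    simpa [Zsqrtd.norm_def] using h
  let f : ℤ√d →+* ZMod p := Zsqrtd.lift ⟨-z.re / z.im, by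
    field_simp
    linear_combination hn⟩
  have hf : Function.Surjective f := fun a => by
    obtain ⟨n, rfl⟩ := ZMod.intCast_surjective a
    exact ⟨n, map_intCast f n⟩
  refine ⟨RingHom.ker f, RingHom.ker_isPrime f, ?_, ?_⟩
  · rw [Nat.card_congr (RingHom.quotientKerEquivOfSurjective hf).toEquiv, Nat.card_zmod]
  · rw [RingHom.mem_ker]
    simp only [f, Zsqrtd.lift_apply_apply]
    field_simp
    ring

/-- Ideals of coprime finite index are coprime. -/
theorem Ideal.isCoprime_of_coprime_card_quotient {R : Type*} [CommRing R] {I J : Ideal R}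
    (h : (Nat.card (R ⧸ I)).Coprime (Nat.card (R ⧸ J))) : IsCoprime I J := by
  have key (K : Ideal R) : ((Nat.card (R ⧸ K) : ℕ) : R) ∈ K := by
    rw [← Ideal.Quotient.eq_zero_iff_mem, map_natCast]
    simpa using card_nsmul_eq_zero' (x := (1 : R ⧸ K))
  obtain ⟨a, b, hab⟩ := Nat.isCoprime_iff_coprime.2 h
  rw [Ideal.isCoprime_iff_exists]
  refine ⟨_, I.mul_mem_left (a : R) (key I), _, J.mul_mem_left (b : R) (key J), ?_⟩
  exact_mod_cast congrArg (Int.cast : ℤ → R) hab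

/-- The index is multiplicative on products of pairwise coprime ideals. -/
theorem Ideal.card_quotient_prod {R ι : Type*} [CommRing R] [Fintype ι] (I : ι → Ideal R)
    (h : Pairwise fun i j => IsCoprime (I i) (I j)) :
    Nat.card (R ⧸ ∏ i, I i) = ∏ i, Nat.card (R ⧸ I i) := by
  rw [Ideal.prod_eq_iInf_of_pairwise_isCoprime (fun i _ j _ hij => h hij)]
  simp only [Finset.mem_univ, iInf_pos]
  rw [Nat.card_congr (Ideal.quotientInfRingEquivPiQuotient I h).toEquiv, Nat.card_pi]

/-- Nested ideals of the same finite index are equal. -/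
theorem Ideal.eq_of_le_of_card_quotient_eq {R : Type*} [CommRing R] {I J : Ideal R} (hle : I ≤ J)
    (h0 : Nat.card (R ⧸ J) ≠ 0) (h : Nat.card (R ⧸ I) = Nat.card (R ⧸ J)) : I = J := by
  refine le_antisymm hle ?_
  have hle' : I.toAddSubgroup ≤ J.toAddSubgroup := hle
  have hmul : _ * Nat.card (R ⧸ J) = Nat.card (R ⧸ I) := AddSubgroup.relIndex_mul_index hle'
  rw [h] at hmul
  exact AddSubgroup.relIndex_eq_one.1 (mul_eq_right₀ h0 |>.1 hmul)

theorem Squarefree.injective_of_eq_prod {ι : Type*} [Fintype ι] {p : ι → ℕ} {m : ℕ}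
    (hm : Squarefree m) (hp : ∀ i, (p i).Prime) (h : m = ∏ i, p i) : Function.Injective p := by
  classical
  intro i j hij
  by_contra hne
  refine (hp i).not_isUnit (hm (p i) ?_)
  have hdvd := Finset.prod_dvd_prod_of_subset {i, j} Finset.univ p (Finset.subset_univ _)
  rwa [Finset.prod_pair hne, ← hij, ← h] at hdvd

/-- Let `d` be a squarefree positive integer with `d ≡ 1` or `2 (mod 4)`,
and let `m` be a squarefree positive integer with `gcd(m, 2d) = 1` and prime factorization
`m = p₁⋯p_r`. Then there exist integers `x, y` with `x² + d·y² = m` if and only if there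
exist prime ideals `𝔮₁, …, 𝔮_r` of `ℤ[√-d]` with `N(𝔮ᵢ) = pᵢ` for each `i` (the norm being
the index `[ℤ[√-d] : 𝔮ᵢ]`) such that the product `𝔮₁⋯𝔮_r` is a principal ideal. -/
theorem stmt10 (d : ℕ) (hd : 0 < d) (hdsf : Squarefree d) (hd4 : d % 4 = 1 ∨ d % 4 = 2)
    (m : ℕ) (hm : 0 < m) (hmsf : Squarefree m) (hgcd : Nat.gcd m (2 * d) = 1)
    (r : ℕ) (p : Fin r → ℕ) (hp : ∀ i, (p i).Prime) (hfact : m = ∏ i, p i) :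
    (∃ x y : ℤ, x ^ 2 + (d : ℤ) * y ^ 2 = (m : ℤ)) ↔
      ∃ 𝔮 : Fin r → Ideal (ℤ√(-(d : ℤ))),
        (∀ i, (𝔮 i).IsPrime ∧ Nat.card ((ℤ√(-(d : ℤ))) ⧸ 𝔮 i) = p i) ∧
        (∏ i, 𝔮 i).IsPrincipal := by
  have hinj := hmsf.injective_of_eq_prod hp hfact
  have hcop (𝔮 : Fin r → Ideal (ℤ√(-(d : ℤ))))
      (hcard : ∀ i, Nat.card (ℤ√(-(d : ℤ)) ⧸ 𝔮 i) = p i) :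
      Pairwise fun i j => IsCoprime (𝔮 i) (𝔮 j) := fun i j hij =>
    Ideal.isCoprime_of_coprime_card_quotient <| by
      rw [hcard, hcard]
      exact (Nat.coprime_primes (hp i) (hp j)).2 (hinj.ne hij)
  have hprod (𝔮 : Fin r → Ideal (ℤ√(-(d : ℤ))))
      (hcard : ∀ i, Nat.card (ℤ√(-(d : ℤ)) ⧸ 𝔮 i) = p i) :
      Nat.card (ℤ√(-(d : ℤ)) ⧸ ∏ i, 𝔮 i) = m := by
    rw [Ideal.card_quotient_prod 𝔮 (hcop 𝔮 hcard), hfact]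
    exact Finset.prod_congr rfl fun i _ => hcard i
  constructor
  · rintro ⟨x, y, hxy⟩
    let z : ℤ√(-(d : ℤ)) := ⟨x, y⟩
    have hz : z.norm = m := by
      rw [Zsqrtd.norm_def, ← hxy]
      ring
    have hdvd (i) : (p i : ℤ) ∣ m :=
      Int.natCast_dvd_natCast.2 (hfact ▸ Finset.dvd_prod_of_mem p (Finset.mem_univ i))
    have hy (i) : ¬ (p i : ℤ) ∣ y := by
      intro hpy
      have hpi : Prime (p i : ℤ) := Nat.prime_iff_prime_int.1 (hp i)
      have hpx : (p i : ℤ) ∣ x := by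
        refine hpi.dvd_of_dvd_pow (n := 2) ((Int.dvd_add_left ?_).1 (hxy ▸ hdvd i))
        exact (dvd_pow hpy two_ne_zero).mul_left _
      have hsq : ((p i : ℤ)) ^ 2 ∣ m := by
        rw [← hxy]
        exact dvd_add (pow_dvd_pow_of_dvd hpx 2) ((pow_dvd_pow_of_dvd hpy 2).mul_left _)
      refine (hp i).not_isUnit (hmsf (p i) ?_)
      rw [← sq]
      exact_mod_cast hsq
    choose 𝔮 hprime hcard hmem using fun i =>
      Zsqrtd.exists_isPrime_card_quotient_eq (z := z) (hp i) (hz ▸ hdvd i) (hy i)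
    refine ⟨𝔮, fun i => ⟨hprime i, hcard i⟩, z, ?_⟩
    refine (Ideal.eq_of_le_of_card_quotient_eq ?_ ?_ ?_).symm
    · rw [Ideal.prod_eq_iInf_of_pairwise_isCoprime fun i _ j _ hij => hcop 𝔮 hcard hij]
      simpa [Ideal.span_le] using hmem
    · rw [hprod 𝔮 hcard]
      exact hm.ne'
    · rw [hprod 𝔮 hcard]
      refine (Zsqrtd.card_quotient_span_singleton ?_).trans ?_
      · rw [hz]
        exact_mod_cast hm.ne'
      · rw [hz, Int.natAbs_natCast]
  · rintro ⟨𝔮, h𝔮, z, hz⟩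
    have hcard := hprod 𝔮 fun i => (h𝔮 i).2
    rw [hz] at hcard
    have hnorm : z.norm ≠ 0 := by
      intro h0
      have : Infinite (ℤ√(-(d : ℤ))) := (Zsqrtd.coordEquiv _).toEquiv.infinite_iff.2 inferInstance
      rw [(Zsqrtd.norm_eq_zero_iff (by omega) z).1 h0, Submodule.span_zero_singleton,
        ← Submodule.cardQuot_apply, Submodule.cardQuot_bot] at hcard
      exact hm.ne hcard
    refine ⟨z.re, z.im, ?_⟩
    have h := (Zsqrtd.card_quotient_span_singleton hnorm).symm.trans hcard
    have hnonneg : 0 ≤ z.norm := Zsqrtd.norm_nonneg (by omega) z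
    rw [← h, Int.natAbs_of_nonneg hnonneg, Zsqrtd.norm_def]
    ring
end

section
/- Let d be a squarefree positive integer with d ≡ 1 or 2 (mod 4), let 𝔞 be a nonzero ideal of ℤ[√-d], and let α, β ∈ 𝔞 be elements that generate 𝔞 as a ℤ-module. Let m be a positive integer. Then there exist integers x, y with N(xα + yβ) = m·N(𝔞) (where N is the element norm of ℚ(√-d)) if and only if there exists a nonzero ideal 𝔟 of ℤ[√-d] with N(𝔟) = m whose class in the class group of ℤ[√-d] is the inverse of the class of 𝔞. -/
open NumberField

/-- If `1, θ` generate `R` over `ℤ` and `θ ^ 2 = -d` with `d > 0`, then norms from `R` to `ℤ`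
are nonnegative, being values of the form `x ^ 2 + d * y ^ 2`. -/
theorem norm_nonneg_of_sq_eq_neg {R : Type*} [CommRing R] [IsDomain R] [CharZero R]
    {d : ℕ} (hd : 0 < d) {θ : R} (hθ : θ ^ 2 = -(d : R))
    (hgen : ∀ z : R, ∃ x y : ℤ, z = (x : R) + (y : R) * θ) (z : R) :
    0 ≤ Algebra.norm ℤ z := by
  have hli : LinearIndependent ℤ ![(1 : R), θ] := by
    rw [LinearIndependent.pair_iff]
    intro s t h
    simp only [zsmul_eq_mul, mul_one] at h
    have h2 : (s : R) ^ 2 + d * (t : R) ^ 2 = 0 := by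
      linear_combination ((s : R) - t * θ) * h + (t : R) ^ 2 * hθ
    have h3 : s ^ 2 + (d : ℤ) * t ^ 2 = 0 := by exact_mod_cast h2
    have hd' : (0 : ℤ) < d := by exact_mod_cast hd
    have ht : t = 0 := by
      by_contra ht
      have := mul_pos hd' (pow_pos (abs_pos.mpr ht) 2)
      rw [sq_abs] at this
      nlinarith [sq_nonneg s]
    subst ht
    simpa using h3
  have hsp : ⊤ ≤ Submodule.span ℤ (Set.range ![(1 : R), θ]) := by
    intro w _
    obtain ⟨x, y, rfl⟩ := hgen w
    rw [Matrix.range_cons, Matrix.range_cons, Matrix.range_empty, Set.union_empty,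
      Set.singleton_union, Submodule.mem_span_pair]
    exact ⟨x, y, by simp⟩
  let b := Module.Basis.mk hli hsp
  have hb0 : b 0 = 1 := by simp [b]
  have hb1 : b 1 = θ := by simp [b]
  have hrepr (x y : ℤ) (i : Fin 2) : b.repr ((x : R) + y * θ) i = ![x, y] i := by
    have : (x : R) + y * θ = ∑ j, ![x, y] j • b j := by
      simp [Fin.sum_univ_two, hb0, hb1]
    rw [this, Module.Basis.repr_sum_self]
  obtain ⟨x, y, rfl⟩ := hgen z
  have hmul : ((x : R) + y * θ) * θ = ((-(d * y) : ℤ) : R) + (x : ℤ) * θ := by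
    push_cast
    linear_combination (y : R) * hθ
  rw [Algebra.norm_eq_matrix_det b, Matrix.det_fin_two]
  simp only [Algebra.leftMulMatrix_eq_repr_mul, hb0, hb1, mul_one, hmul, hrepr]
  simp only [Matrix.cons_val_zero, Matrix.cons_val_one]
  nlinarith [sq_nonneg x, mul_nonneg (Int.natCast_nonneg d) (sq_nonneg y)]

/-- An ideal `I` has an element of absolute norm `m * N(I)` iff the inverse class of `I` contains
an ideal of norm `m`. -/
theorem exists_mem_absNorm_span_eq_mul_iff {R : Type*} [CommRing R] [IsDedekindDomain R]
    [Module.Free ℤ R] [Module.Finite ℤ R] [CharZero R] {I : Ideal R} (hI : I ≠ 0)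
    {m : ℕ} (hm : 0 < m) :
    (∃ z ∈ I, (Algebra.norm ℤ z).natAbs = m * Ideal.absNorm I) ↔
      ∃ (J : Ideal R) (hJ : J ≠ 0), Ideal.absNorm J = m ∧
        ClassGroup.mk0 ⟨J, mem_nonZeroDivisors_of_ne_zero hJ⟩ =
          (ClassGroup.mk0 ⟨I, mem_nonZeroDivisors_of_ne_zero hI⟩)⁻¹ := by
  have hN : Ideal.absNorm I ≠ 0 := by rwa [Ne, Ideal.absNorm_eq_zero_iff]
  have hclass (J : Ideal R) (hJ : J ≠ 0) :
      ClassGroup.mk0 ⟨J, mem_nonZeroDivisors_of_ne_zero hJ⟩ =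
          (ClassGroup.mk0 ⟨I, mem_nonZeroDivisors_of_ne_zero hI⟩)⁻¹ ↔
        (J * I).IsPrincipal := by
    rw [eq_inv_iff_mul_eq_one, ← map_mul, ClassGroup.mk0_eq_one_iff]
    rfl
  constructor
  · rintro ⟨z, hz, hnorm⟩
    obtain ⟨J, hJ⟩ := Ideal.dvd_iff_le.mpr ((Ideal.span_singleton_le_iff_mem I).mpr hz)
    have hJm : Ideal.absNorm J = m := by
      rw [← Ideal.absNorm_span_singleton, hJ, map_mul, mul_comm] at hnorm
      exact Nat.eq_of_mul_eq_mul_right (Nat.pos_of_ne_zero hN) hnorm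
    have hJ0 : J ≠ 0 := by
      rintro rfl
      simp at hJm
      omega
    refine ⟨J, hJ0, hJm, (hclass J hJ0).mpr ?_⟩
    rw [mul_comm, ← hJ]
    exact ⟨z, rfl⟩
  · rintro ⟨J, hJ0, hJm, hJ⟩
    obtain ⟨z, hz⟩ := (hclass J hJ0).mp hJ
    rw [Ideal.submodule_span_eq] at hz
    refine ⟨z, Ideal.mul_le_right (I := J) ?_, ?_⟩
    · rw [hz]
      exact Ideal.mem_span_singleton_self z
    · rw [← Ideal.absNorm_span_singleton, ← hz, map_mul, hJm]

/-- Let `d` be a squarefree positive integer with `d ≡ 1` or `2 (mod 4)`,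
so that `ℤ[√-d]` is the full ring of integers `𝓞 K` of `K = ℚ(√-d)` (we encode this by a
number field `K` and an element `θ = √-d` of `𝓞 K` with `θ² = −d` such that `1, θ`
generate `𝓞 K` over `ℤ`).  Let `𝔞` be a nonzero ideal of `𝓞 K` and let `α, β ∈ 𝔞`
generate `𝔞` as a `ℤ`-module. Let `m` be a positive integer. Then there exist integers
`x, y` with `N(xα + yβ) = m·N(𝔞)` (where `N` is the element norm) if and only if there
exists a nonzero ideal `𝔟` of `𝓞 K` with `N(𝔟) = m` whose class in the class group is
the inverse of the class of `𝔞`. -/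
theorem stmt11 (d : ℕ) (hd : 0 < d) (hdsf : Squarefree d) (hd4 : d % 4 = 1 ∨ d % 4 = 2)
    (K : Type*) [Field K] [NumberField K]
    (θ : 𝓞 K) (hθ : θ ^ 2 = -(d : 𝓞 K))
    (hgen : ∀ z : 𝓞 K, ∃ x y : ℤ, z = (x : 𝓞 K) + (y : 𝓞 K) * θ)
    (𝔞 : Ideal (𝓞 K)) (h𝔞 : 𝔞 ≠ 0)
    (α β : 𝓞 K)
    (hspan : Submodule.span ℤ ({α, β} : Set (𝓞 K)) = Submodule.restrictScalars ℤ 𝔞)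
    (m : ℕ) (hm : 0 < m) :
    (∃ x y : ℤ, Algebra.norm ℤ ((x : 𝓞 K) * α + (y : 𝓞 K) * β)
        = (m : ℤ) * (Ideal.absNorm 𝔞 : ℤ)) ↔
      ∃ (𝔟 : Ideal (𝓞 K)) (h𝔟 : 𝔟 ≠ 0), Ideal.absNorm 𝔟 = m ∧
        ClassGroup.mk0 ⟨𝔟, mem_nonZeroDivisors_of_ne_zero h𝔟⟩ =
          (ClassGroup.mk0 ⟨𝔞, mem_nonZeroDivisors_of_ne_zero h𝔞⟩)⁻¹ := by
  rw [← exists_mem_absNorm_span_eq_mul_iff h𝔞 hm]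
  have hmem (z : 𝓞 K) : z ∈ 𝔞 ↔ ∃ x y : ℤ, (x : 𝓞 K) * α + (y : 𝓞 K) * β = z := by
    rw [← Submodule.restrictScalars_mem ℤ, ← hspan, Submodule.mem_span_pair]
    simp only [zsmul_eq_mul]
  have hnorm (z : 𝓞 K) : Algebra.norm ℤ z = (m : ℤ) * (Ideal.absNorm 𝔞 : ℤ) ↔
      (Algebra.norm ℤ z).natAbs = m * Ideal.absNorm 𝔞 := by
    rw [← Int.natCast_inj, Int.natAbs_of_nonneg (norm_nonneg_of_sq_eq_neg hd hθ hgen z),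
      Nat.cast_mul]
  simp only [hnorm, hmem]
  constructor
  · rintro ⟨x, y, h⟩
    exact ⟨_, ⟨x, y, rfl⟩, h⟩
  · rintro ⟨_, ⟨x, y, rfl⟩, h⟩
    exact ⟨x, y, h⟩
end

section
/- Let d be a squarefree positive integer with d ≡ 1 or 2 (mod 4), let 𝔞 be a nonzero ideal of ℤ[√-d], and let α, β ∈ 𝔞 be elements that generate 𝔞 as a ℤ-module. Let m be a squarefree positive integer with prime factorization m = p₁⋯p_r. Then there exist integers x, y with N(xα + yβ) = m·N(𝔞) if and only if there exist prime ideals 𝔮₁, …, 𝔮_r of ℤ[√-d] with N(𝔮_i) = p_i for each i such that the class of the product 𝔮₁⋯𝔮_r in the class group of ℤ[√-d] equals the inverse of the class of 𝔞. -/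
open NumberField

/-- The norm form of `R = ℤ[√-d]` with respect to the `ℤ`-basis `1, √-d`. -/
theorem norm_add_mul_of_sq_eq_neg {R : Type*} [CommRing R] [CharZero R] {d : ℕ} (hd : 0 < d)
    {θ : R} (hθ : θ ^ 2 = -(d : R)) (hgen : ∀ z : R, ∃ x y : ℤ, z = (x : R) + (y : R) * θ)
    (x y : ℤ) : Algebra.norm ℤ ((x : R) + (y : R) * θ) = x ^ 2 + d * y ^ 2 := by
  have hli : LinearIndependent ℤ ![(1 : R), θ] := by
    refine LinearIndependent.pair_iff.mpr fun s t h => ?_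
    simp only [zsmul_eq_mul, mul_one] at h
    have h2 : ((s ^ 2 + d * t ^ 2 : ℤ) : R) = 0 := by
      push_cast
      linear_combination ((s : R) - t * θ) * h + (t : R) ^ 2 * hθ
    have h3 : s ^ 2 + d * t ^ 2 = 0 := by exact_mod_cast h2
    have hd' : (0 : ℤ) < d := by exact_mod_cast hd
    have ht : 0 ≤ (d : ℤ) * t ^ 2 := by positivity
    have hs : s ^ 2 = 0 := le_antisymm (by linarith) (sq_nonneg s)
    have ht' : (d : ℤ) * t ^ 2 = 0 := by linarith
    exact ⟨by simpa using hs, by simpa [hd.ne'] using ht'⟩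
  have hsp : ⊤ ≤ Submodule.span ℤ (Set.range ![(1 : R), θ]) := by
    rintro z -
    obtain ⟨a, b, rfl⟩ := hgen z
    rw [Matrix.range_cons, Matrix.range_cons, Matrix.range_empty, Set.union_empty,
      Set.singleton_union, Submodule.mem_span_pair]
    exact ⟨a, b, by simp⟩
  let B := Module.Basis.mk hli hsp
  have hB0 : B 0 = 1 := by simp [B]
  have hB1 : B 1 = θ := by simp [B]
  have e0 : ((x : R) + y * θ) * B 0 = x • B 0 + y • B 1 := by
    simp [hB0, hB1]
  have e1 : ((x : R) + y * θ) * B 1 = (-(d * y)) • B 0 + x • B 1 := by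
    simp only [hB0, hB1, zsmul_eq_mul]
    push_cast
    linear_combination (y : R) * hθ
  rw [Algebra.norm_eq_matrix_det B, Matrix.det_fin_two]
  simp only [Algebra.leftMulMatrix_eq_repr_mul, e0, e1, map_add, map_zsmul, B.repr_self]
  simp
  ring

/-- An ideal whose norm is a squarefree product of primes is the product of prime ideals of
these norms. -/
theorem Ideal.exists_prod_eq_of_absNorm_eq_prod {S : Type*} [CommRing S]
    [IsDedekindDomain S] [Module.Free ℤ S] [Module.Finite ℤ S] {ι : Type*} [Fintype ι]
    {p : ι → ℕ} (hp : ∀ i, (p i).Prime) (hsf : Squarefree (∏ i, p i)) {I : Ideal S}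
    (hI : Ideal.absNorm I = ∏ i, p i) :
    ∃ P : ι → Ideal S, (∀ i, (P i).IsPrime ∧ Ideal.absNorm (P i) = p i) ∧ ∏ i, P i = I := by
  have hpI (i : ι) : p i ∣ Ideal.absNorm I := hI ▸ Finset.dvd_prod_of_mem p (Finset.mem_univ i)
  choose P hmax hunder hdvd using fun i =>
    Ideal.exists_isMaximal_dvd_of_dvd_absNorm' (hp i) I (hpI i)
  have hnorm (i : ι) : Ideal.absNorm (P i) = p i := by
    have := hmax i
    obtain ⟨q, n, hn, hqP, hq, h⟩ := Ideal.exists_prime_and_absNorm_eq_pow (P i)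
    have hpq : p i = q := by
      have : (q : ℤ) ∈ (P i).under ℤ := by simpa [Ideal.mem_comap] using hqP
      rw [hunder, Ideal.mem_span_singleton, Int.natCast_dvd_natCast] at this
      exact (Nat.prime_dvd_prime_iff_eq (hp i) hq).mp this
    have hsq : Squarefree (q ^ n) :=
      hsf.squarefree_of_dvd (hI ▸ h ▸ map_dvd Ideal.absNorm (hdvd i))
    obtain rfl : n = 1 :=
      (Squarefree.eq_zero_or_one_of_pow_of_not_isUnit hsq
        (by simpa using hq.ne_one)).resolve_left hn.ne'
    rw [h, hpq, pow_one]
  have hpinj : Function.Injective p := by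
    classical
    intro i j hij
    by_contra hne
    have h : p i * p j ∣ ∏ k, p k := by
      rw [← Finset.prod_pair hne]
      exact Finset.prod_dvd_prod_of_subset _ _ _ (Finset.subset_univ _)
    rw [← hij] at h
    exact (hp i).one_lt.ne' (Nat.isUnit_iff.mp (hsf _ h))
  have hprod : ∏ i, P i ∣ I := by
    refine Finset.prod_dvd_of_coprime (fun i _ j _ hij => ?_) fun i _ => hdvd i
    have := hmax i
    have := hmax j
    refine Ideal.isCoprime_of_isMaximal fun h => hij (hpinj ?_)
    rw [← hnorm i, ← hnorm j, h]
  obtain ⟨J, hJ⟩ := hprod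
  refine ⟨P, fun i => ⟨(hmax i).isPrime, hnorm i⟩, ?_⟩
  have hpos : 0 < ∏ i, p i := Finset.prod_pos fun i _ => (hp i).pos
  have hJ1 : Ideal.absNorm J = 1 := by
    rw [hJ, map_mul, map_prod, Finset.prod_congr rfl fun i _ => hnorm i] at hI
    exact Nat.eq_of_mul_eq_mul_left hpos (by simpa using hI)
  rw [hJ, Ideal.absNorm_eq_one_iff.mp hJ1, Ideal.mul_top]

/-- Let `d` be a squarefree positive integer with `d ≡ 1` or `2 (mod 4)`,
so that `ℤ[√-d]` is the full ring of integers `𝓞 K` of `K = ℚ(√-d)` (we encode this by a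
number field `K` and an element `θ = √-d` of `𝓞 K` with `θ² = −d` such that `1, θ`
generate `𝓞 K` over `ℤ`).  Let `𝔞` be a nonzero ideal of `𝓞 K` and let `α, β ∈ 𝔞`
generate `𝔞` as a `ℤ`-module. Let `m` be a squarefree positive integer with prime
factorization `m = p₁⋯p_r`. Then there exist integers `x, y` with `N(xα + yβ) = m·N(𝔞)`
if and only if there exist prime ideals `𝔮₁, …, 𝔮_r` of `𝓞 K` with `N(𝔮ᵢ) = pᵢ` for each
`i` such that the class of the product `𝔮₁⋯𝔮_r` in the class group of `𝓞 K` equals the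
inverse of the class of `𝔞`. -/
theorem stmt12 (d : ℕ) (hd : 0 < d) (hdsf : Squarefree d) (hd4 : d % 4 = 1 ∨ d % 4 = 2)
    (K : Type*) [Field K] [NumberField K]
    (θ : 𝓞 K) (hθ : θ ^ 2 = -(d : 𝓞 K))
    (hgen : ∀ z : 𝓞 K, ∃ x y : ℤ, z = (x : 𝓞 K) + (y : 𝓞 K) * θ)
    (𝔞 : Ideal (𝓞 K)) (h𝔞 : 𝔞 ≠ 0)
    (α β : 𝓞 K)
    (hspan : Submodule.span ℤ ({α, β} : Set (𝓞 K)) = Submodule.restrictScalars ℤ 𝔞)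
    (m : ℕ) (hm : 0 < m) (hmsf : Squarefree m)
    (r : ℕ) (p : Fin r → ℕ) (hp : ∀ i, (p i).Prime) (hfact : m = ∏ i, p i) :
    (∃ x y : ℤ, Algebra.norm ℤ ((x : 𝓞 K) * α + (y : 𝓞 K) * β)
        = (m : ℤ) * (Ideal.absNorm 𝔞 : ℤ)) ↔
      ∃ (𝔮 : Fin r → Ideal (𝓞 K)) (hq : ∏ i, 𝔮 i ≠ 0),
        (∀ i, (𝔮 i).IsPrime ∧ Ideal.absNorm (𝔮 i) = p i) ∧
        ClassGroup.mk0 ⟨∏ i, 𝔮 i, mem_nonZeroDivisors_of_ne_zero hq⟩ =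
          (ClassGroup.mk0 ⟨𝔞, mem_nonZeroDivisors_of_ne_zero h𝔞⟩)⁻¹ := by
  have hnn (z : 𝓞 K) : Algebra.norm ℤ z = (Ideal.absNorm (Ideal.span {z}) : ℤ) := by
    obtain ⟨x, y, rfl⟩ := hgen z
    rw [Ideal.absNorm_span_singleton, Int.natCast_natAbs, abs_of_nonneg]
    rw [norm_add_mul_of_sq_eq_neg hd hθ hgen]
    positivity
  have hmem (z : 𝓞 K) : z ∈ 𝔞 ↔ ∃ x y : ℤ, (x : 𝓞 K) * α + (y : 𝓞 K) * β = z := by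
    rw [← Submodule.restrictScalars_mem ℤ 𝔞 z, ← hspan, Submodule.mem_span_pair]
    simp only [zsmul_eq_mul]
  simp only [ClassGroup.mk0_eq_mk0_inv_iff]
  constructor
  · rintro ⟨x, y, h⟩
    have hz := (hmem _).mpr ⟨x, y, rfl⟩
    generalize (x : 𝓞 K) * α + (y : 𝓞 K) * β = z at h hz
    rw [hnn] at h
    norm_cast at h
    obtain ⟨I, hI⟩ := Ideal.dvd_span_singleton.mpr hz
    have h𝔞pos : 0 < Ideal.absNorm 𝔞 :=
      Nat.pos_of_ne_zero (mt Ideal.absNorm_eq_zero_iff.mp h𝔞)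
    have hIm : Ideal.absNorm I = ∏ i, p i := by
      rw [hI, map_mul, mul_comm] at h
      rw [← hfact]
      exact Nat.eq_of_mul_eq_mul_right h𝔞pos h
    obtain ⟨𝔮, h𝔮, rfl⟩ := Ideal.exists_prod_eq_of_absNorm_eq_prod hp (hfact ▸ hmsf) hIm
    have hq : ∏ i, 𝔮 i ≠ 0 := fun h0 => by
      rw [h0, map_zero, ← hfact] at hIm
      exact hm.ne hIm
    refine ⟨𝔮, hq, h𝔮, z, ?_, by rw [hI, mul_comm]⟩
    rintro rfl
    rw [Ideal.span_singleton_zero] at hI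
    exact mul_ne_zero h𝔞 hq hI.symm
  · rintro ⟨𝔮, hq, h𝔮, z, -, hz⟩
    have hz𝔞 : z ∈ 𝔞 := Ideal.dvd_span_singleton.mp ⟨_, by rw [← hz, mul_comm]⟩
    obtain ⟨x, y, rfl⟩ := (hmem z).mp hz𝔞
    refine ⟨x, y, ?_⟩
    rw [hnn, ← hz, map_mul, map_prod, Finset.prod_congr rfl fun i _ => (h𝔮 i).2, hfact,
      Nat.cast_mul]
end
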